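/- For a finite binary word α: (i) c(α·w) = d(α·w) for every finite word w if and only if 1^{3n+2}·0 is a prefix of α for some natural number n; (ii) b(α·w) = d(α·w) for every finite word w if and only if 1^{3n+1}·0 is a prefix of α for some n; (iii) c(α·w) = b(α·w) for every finite word w if and only if 1^{3n}·0 is a prefix of α for some n. -/

import Mathlib

/-- Generator `a` of the Grigorchuk group acting on finite binary words. -/
def grigA : List Bool → List Bool
  | [] => []
  | x :: w => (!x) :: w

mutual
  /-- Generator `b` of the Grigorchuk group acting on finite binary words. -/
  def grigB : List Bool → List Bool
    | [] => []
    | false :: w => false :: grigA w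
    | true :: w => true :: grigC w
  /-- Generator `c` of the Grigorchuk group acting on finite binary words. -/
  def grigC : List Bool → List Bool
    | [] => []
    | false :: w => false :: grigA w
    | true :: w => true :: grigD w
  /-- Generator `d` of the Grigorchuk group acting on finite binary words. -/
  def grigD : List Bool → List Bool
    | [] => []
    | false :: w => false :: w
    | true :: w => true :: grigB w
end

theorem grigA_append_singleton_ne (u : List Bool) (x : Bool) :
    grigA (u ++ [x]) ≠ u ++ [x] := by
  cases u <;> simp [grigA]

theorem exists_replicate_prefix_nil (f : ℕ → ℕ) :
    ¬ ∃ n, (List.replicate (f n) true ++ [false]) <+: ([] : List Bool) := by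
  simp

theorem replicate_succ_prefix_false_cons (k : ℕ) (β : List Bool) :
    ¬ (List.replicate (k + 1) true ++ [false]) <+: (false :: β) := by
  simp [List.replicate_succ]

theorem replicate_succ_prefix_true_cons (k : ℕ) (β : List Bool) :
    (List.replicate (k + 1) true ++ [false]) <+: (true :: β) ↔
      (List.replicate k true ++ [false]) <+: β := by
  simp [List.replicate_succ]

theorem exists_replicate_three_mul_prefix_true_cons (β : List Bool) :
    (∃ n : ℕ, (List.replicate (3 * n) true ++ [false]) <+: (true :: β)) ↔
      ∃ n : ℕ, (List.replicate (3 * n + 2) true ++ [false]) <+: β := by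
  constructor
  · rintro ⟨_ | n, h⟩
    · simp at h
    · exact ⟨n, (replicate_succ_prefix_true_cons _ _).1 h⟩
  · rintro ⟨n, h⟩
    exact ⟨n + 1, (replicate_succ_prefix_true_cons _ _).2 h⟩

/-- Two distinct Grigorchuk generators agree on all extensions of a word `α`
exactly when a suitable word `1^k·0` is a prefix of `α`:
`c = d` beyond `α` iff `1^{3n+2}·0 <+: α`; `b = d` beyond `α` iff
`1^{3n+1}·0 <+: α`; `c = b` beyond `α` iff `1^{3n}·0 <+: α`. -/
theorem grig_agree_iff_prefix (α : List Bool) :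
    ((∀ w : List Bool, grigC (α ++ w) = grigD (α ++ w)) ↔
      ∃ n : ℕ, (List.replicate (3 * n + 2) true ++ [false]) <+: α) ∧
    ((∀ w : List Bool, grigB (α ++ w) = grigD (α ++ w)) ↔
      ∃ n : ℕ, (List.replicate (3 * n + 1) true ++ [false]) <+: α) ∧
    ((∀ w : List Bool, grigC (α ++ w) = grigB (α ++ w)) ↔
      ∃ n : ℕ, (List.replicate (3 * n) true ++ [false]) <+: α) := by
  induction α with
  | nil =>
    refine ⟨iff_of_false (fun h => ?_) (exists_replicate_prefix_nil _),
      iff_of_false (fun h => ?_) (exists_replicate_prefix_nil _),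
      iff_of_false (fun h => ?_) (exists_replicate_prefix_nil _)⟩
    · simpa [grigC, grigD, grigA] using h [false, false]
    · simpa [grigB, grigD, grigA] using h [false, false]
    · simpa [grigB, grigC, grigD, grigA] using h [true, false, false]
  | cons x β ih =>
    obtain ⟨ihCD, ihBD, ihCB⟩ := ih
    cases x with
    | false =>
      refine ⟨iff_of_false (fun h => ?_) ?_, iff_of_false (fun h => ?_) ?_,
        iff_of_true (fun w => ?_) ⟨0, by simp⟩⟩
      · exact grigA_append_singleton_ne β true (by simpa [grigC, grigD] using h [true])
      · exact fun ⟨_, h⟩ => replicate_succ_prefix_false_cons _ _ h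
      · exact grigA_append_singleton_ne β true (by simpa [grigB, grigD] using h [true])
      · exact fun ⟨_, h⟩ => replicate_succ_prefix_false_cons _ _ h
      · simp [grigB, grigC]
    | true =>
      simp only [List.cons_append, grigB, grigC, grigD, List.cons.injEq, true_and,
        replicate_succ_prefix_true_cons, exists_replicate_three_mul_prefix_true_cons]
      refine ⟨?_, ihCB, ?_⟩
      · simpa only [eq_comm] using ihBD
      · simpa only [eq_comm] using ihCD
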